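/- Let X be a finite simplicial complex and let [C] ∈ H_2(X; Z/2) be a nontrivial homology class. Then there exists a triangulated closed surface S (possibly non-orientable and possibly disconnected) together with a non-degenerate simplicial map h: S → X such that h_*[S] = [C], where [S] ∈ H_2(S; Z/2) denotes the Z/2 fundamental class. Moreover, h does not identify 2-simplices: h(σ) ≠ h(η) for any two distinct 2-simplices σ, η of S. -/

import Mathlib

open scoped Classical

noncomputable section

/-- Simplicial chains with `ℤ/2`-coefficients: finitely supported functions on the
finite sets of vertices (a finite set of cardinality `n + 1` representing an
`n`-simplex). -/
abbrev SimplicialChain (E : Type*) : Type _ := Finset E →₀ ZMod 2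

/-- The `ℤ/2` simplicial boundary operator: the boundary of a simplex is the sum of
its codimension-one faces. -/
def chainBoundary {E : Type*} (c : SimplicialChain E) : SimplicialChain E :=
  c.sum fun s a => a • ∑ x ∈ s, Finsupp.single (s.erase x) (1 : ZMod 2)

/-- The chain `c` is supported on the `n`-dimensional faces of the simplicial
complex `K`. -/
def IsChainOf {E : Type*} [AddCommGroup E] [Module ℝ E]
    (K : Geometry.SimplicialComplex ℝ E) (n : ℕ) (c : SimplicialChain E) : Prop :=
  ∀ s ∈ c.support, s ∈ K.faces ∧ s.card = n + 1

/-- The `ℤ/2` fundamental chain of a finite simplicial complex: the sum of all of its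
`2`-simplices.  For a triangulated closed surface this represents the `ℤ/2`
fundamental class. -/
def fundamentalChain2 {E : Type*} [AddCommGroup E] [Module ℝ E]
    (K : Geometry.SimplicialComplex ℝ E) (h : K.faces.Finite) : SimplicialChain E :=
  ∑ s ∈ h.toFinset.filter (fun s => s.card = 3), Finsupp.single s (1 : ZMod 2)

/-- The push-forward of simplicial chains along a (vertex map of a) simplicial map. -/
def chainMap {E' E : Type*} (φ : E' → E) (c : SimplicialChain E') : SimplicialChain E :=
  c.sum fun s a => Finsupp.single (s.image φ) a

theorem even_card_filter_sdiff {ι : Type*} {P Q : Finset ι} (hP : P ⊆ Q) (p : ι → Prop)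
    [DecidablePred p]
    (hQ : Even (Q.filter p).card) (hPe : Even (P.filter p).card) :
    Even ((Q \ P).filter p).card := by
  have h : ((Q \ P).filter p).card = (Q.filter p).card - (P.filter p).card := by
    rw [← Finset.card_sdiff_of_subset (Finset.filter_subset_filter p hP)]
    congr 1
    ext x
    simp only [Finset.mem_filter, Finset.mem_sdiff]
    tauto
  rw [h]
  exact hQ.tsub hPe

/-- Labels on the corners of a mod `2` two-cycle, splitting every vertex as far as possible:
every link becomes a minimal nonempty even graph. -/
theorem exists_minimal_corner_labelling {V : Type*} (T : Finset (Finset V))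
    (hT : ∀ a b, a ≠ b → Even (T.filter fun t => a ∈ t ∧ b ∈ t).card) :
    ∃ l : Finset V → V → ℕ,
      (∀ a b i j, a ≠ b →
        Even (T.filter fun t => (a ∈ t ∧ l t a = i) ∧ (b ∈ t ∧ l t b = j)).card) ∧
      ∀ a i, ∀ P ⊆ T.filter (fun t => a ∈ t ∧ l t a = i), P.Nonempty →
        (∀ b j, b ≠ a → Even (P.filter fun t => b ∈ t ∧ l t b = j).card) →
        P = T.filter (fun t => a ∈ t ∧ l t a = i) := by
  let good : (Finset V → V → ℕ) → Prop := fun l => ∀ a b i j, a ≠ b →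
    Even (T.filter fun t => (a ∈ t ∧ l t a = i) ∧ (b ∈ t ∧ l t b = j)).card
  let verts : (Finset V → V → ℕ) → Finset (V × ℕ) := fun l =>
    (T.sigma fun t => t).image fun x => (x.2, l x.1 x.2)
  have mem_verts : ∀ l a i, (a, i) ∈ verts l ↔ ∃ t ∈ T, a ∈ t ∧ l t a = i := by
    intro l a i
    simp only [verts, Finset.mem_image, Finset.mem_sigma, Prod.mk.injEq, Sigma.exists]
    constructor
    · rintro ⟨t, b, ⟨h1, h2⟩, rfl, h3⟩
      exact ⟨t, h1, h2, h3⟩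
    · rintro ⟨t, h1, h2, h3⟩
      exact ⟨t, a, ⟨h1, h2⟩, rfl, h3⟩
  have good0 : good fun _ _ => 0 := by
    intro a b i j hab
    by_cases h : i = 0 ∧ j = 0
    · obtain ⟨rfl, rfl⟩ := h
      simpa using hT a b hab
    · rw [Finset.filter_false_of_mem]
      · simp
      · intro t _ h'
        exact h ⟨h'.1.2.symm, h'.2.2.symm⟩
  obtain ⟨l, hl, hmax⟩ : ∃ l, good l ∧ ∀ l', good l' → (verts l').card ≤ (verts l).card := by
    have hfin : (Set.range fun l : {l // good l} => (verts l.1).card).Finite := by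
      refine (Set.finite_Iic (T.sigma fun t => t).card).subset ?_
      rintro _ ⟨l, rfl⟩
      exact Finset.card_image_le
    obtain ⟨_, ⟨l, rfl⟩, h⟩ := Set.exists_max_image _ id hfin ⟨_, ⟨⟨_, good0⟩, rfl⟩⟩
    exact ⟨l.1, l.2, fun l' hl' => h _ ⟨⟨l', hl'⟩, rfl⟩⟩
  refine ⟨l, hl, fun a i P hP hne heven => ?_⟩
  by_contra hPne
  set Q := T.filter (fun t => a ∈ t ∧ l t a = i) with hQ
  obtain ⟨k, hk⟩ := Infinite.exists_notMem_finset ((verts l).image Prod.snd)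
  have hk' : ∀ t ∈ T, ∀ b ∈ t, l t b ≠ k := by
    intro t ht b hb h
    exact hk (Finset.mem_image.2 ⟨(b, k), (mem_verts l b k).2 ⟨t, ht, hb, h⟩, rfl⟩)
  let l' : Finset V → V → ℕ := fun t x => if x = a ∧ t ∈ P then k else l t x
  have hPT : ∀ t ∈ P, t ∈ T ∧ a ∈ t ∧ l t a = i := fun t ht => by
    simpa [hQ] using hP ht
  have l'_ne : ∀ t b, b ≠ a → l' t b = l t b := fun t b hb => by simp [l', hb]
  have hQe : ∀ b j, b ≠ a → Even (Q.filter fun t => b ∈ t ∧ l t b = j).card := by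
    intro b j hb
    rw [hQ, Finset.filter_filter]
    exact hl a b i j hb.symm
  have key : ∀ b i' j, b ≠ a →
      Even (T.filter fun t => (a ∈ t ∧ l' t a = i') ∧ (b ∈ t ∧ l' t b = j)).card := by
    intro b i' j hb
    simp only [l'_ne _ b hb]
    by_cases h1 : i' = k
    · convert heven b j hb using 2
      ext t
      simp only [Finset.mem_filter, l', true_and]
      constructor
      · rintro ⟨h2, ⟨h3, h4⟩, h5⟩
        split_ifs at h4 with h6
        · exact ⟨h6, h5⟩
        · exact (hk' t h2 a h3 (h4.trans h1)).elim
      · rintro ⟨h2, h3⟩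
        exact ⟨(hPT t h2).1, ⟨(hPT t h2).2.1, by simp [h2, h1]⟩, h3⟩
    · by_cases h2 : i' = i
      · convert even_card_filter_sdiff hP (fun t => b ∈ t ∧ l t b = j) (hQe b j hb) (heven b j hb)
          using 2
        ext t
        simp only [Finset.mem_filter, Finset.mem_sdiff, l', true_and, hQ]
        by_cases h3 : t ∈ P
        · simp [h3, Ne.symm h1]
        · simp [h3, h2]; tauto
      · convert hl a b i' j hb.symm using 2
        ext t
        simp only [Finset.mem_filter, l', true_and]
        by_cases h3 : t ∈ P
        · simp [h3, Ne.symm h1, (hPT t h3).2.2, Ne.symm h2]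
        · simp [h3]
  have hgood : good l' := by
    intro x y i' j hxy
    by_cases hx : x = a
    · subst hx
      exact key y i' j hxy.symm
    by_cases hy : y = a
    · subst hy
      simpa only [and_comm] using key x j i' hx
    simp only [l'_ne _ x hx, l'_ne _ y hy]
    exact hl x y i' j hxy
  have hlt : (verts l).card < (verts l').card := by
    apply Finset.card_lt_card
    rw [Finset.ssubset_iff_of_subset]
    · obtain ⟨t, ht⟩ := hne
      refine ⟨(a, k), (mem_verts _ _ _).2 ⟨t, (hPT t ht).1, (hPT t ht).2.1, by simp [l', ht]⟩, ?_⟩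
      rw [mem_verts]
      rintro ⟨s, hs, h1, h2⟩
      exact hk' s hs a h1 h2
    · rintro ⟨x, j⟩ hxj
      obtain ⟨t, ht, hx, rfl⟩ := (mem_verts _ _ _).1 hxj
      by_cases h : x = a ∧ t ∈ P
      · obtain ⟨rfl, htP⟩ := h
        obtain ⟨s, hsQ, hsP⟩ := Finset.exists_of_ssubset (hP.ssubset_of_ne hPne)
        rw [hQ, Finset.mem_filter] at hsQ
        exact (mem_verts _ _ _).2
          ⟨s, hsQ.1, hsQ.2.1, by simp [l', hsP, hsQ.2.2, (hPT t htP).2.2]⟩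
      · exact (mem_verts _ _ _).2 ⟨t, ht, hx, by simp only [l', if_neg h]⟩
  exact absurd (hmax l' hgood) (not_le.2 hlt)

/-- Every mod `2` two-cycle of triangles unfolds, injectively on triangles, to a family of
triangles on `Fin N` in which every link is a minimal nonempty even graph. -/
theorem exists_minimal_unfolding {V : Type*} (T : Finset (Finset V))
    (hT : ∀ a b, a ≠ b → Even (T.filter fun t => a ∈ t ∧ b ∈ t).card) :
    ∃ (N : ℕ) (f : Fin N → V) (τ : Finset V → Finset (Fin N)),
      (∀ t, Set.InjOn f (τ t)) ∧ (∀ t ∈ T, (τ t).image f = t) ∧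
      (∀ a b, a ≠ b → Even (T.filter fun t => a ∈ τ t ∧ b ∈ τ t).card) ∧
      ∀ v, ∀ P ⊆ T.filter (fun t => v ∈ τ t), P.Nonempty →
        (∀ b, b ≠ v → Even (P.filter fun t => b ∈ τ t).card) →
        P = T.filter (fun t => v ∈ τ t) := by
  obtain ⟨l, hl, hmin⟩ := exists_minimal_corner_labelling T hT
  let W : Finset (V × ℕ) := (T.sigma fun t => t).image fun x => (x.2, l x.1 x.2)
  let π : Fin W.card → V × ℕ := fun k => (W.equivFin.symm k).1
  have hπ : Function.Injective π := Subtype.val_injective.comp W.equivFin.symm.injective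
  have hsurj : ∀ t ∈ T, ∀ a ∈ t, ∃ k, π k = (a, l t a) := by
    intro t ht a ha
    have : (a, l t a) ∈ W :=
      Finset.mem_image.2 ⟨⟨t, a⟩, Finset.mem_sigma.2 ⟨ht, ha⟩, rfl⟩
    exact ⟨W.equivFin ⟨_, this⟩, by simp [π]⟩
  let τ : Finset V → Finset (Fin W.card) := fun t =>
    Finset.univ.filter fun k => (π k).1 ∈ t ∧ l t (π k).1 = (π k).2
  have mem_τ : ∀ t k, k ∈ τ t ↔ (π k).1 ∈ t ∧ l t (π k).1 = (π k).2 := by simp [τ]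
  have hinj : ∀ t, Set.InjOn (fun k => (π k).1) (τ t) := by
    intro t j hj k hk hjk
    have h1 := (mem_τ t j).1 hj
    have h2 := (mem_τ t k).1 hk
    have hjk' : (π j).1 = (π k).1 := hjk
    exact hπ (Prod.ext hjk' (by rw [← h1.2, ← h2.2, hjk']))
  refine ⟨W.card, fun k => (π k).1, τ, hinj, fun t ht => ?_, fun a b hab => ?_,
    fun v P hP hne heven => ?_⟩
  · ext a
    simp only [Finset.mem_image, mem_τ]
    constructor
    · rintro ⟨k, ⟨h, _⟩, rfl⟩
      exact h
    · intro ha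
      obtain ⟨k, hk⟩ := hsurj t ht a ha
      exact ⟨k, by simp [hk, ha], by simp [hk]⟩
  · by_cases h : (π a).1 = (π b).1
    · rw [Finset.filter_false_of_mem]
      · simp
      · intro t _ ht
        exact hab (hinj t ht.1 ht.2 h)
    · simp only [mem_τ]
      exact hl _ _ _ _ h
  · simp only [mem_τ] at hP ⊢
    refine hmin _ _ P hP hne fun b j hb => ?_
    by_cases h : ∃ k, π k = (b, j)
    · obtain ⟨k, hk⟩ := h
      have := heven k (by rintro rfl; exact hb (by rw [hk]))
      simpa [mem_τ, hk] using this
    · rw [Finset.filter_false_of_mem]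
      · simp
      · rintro t ht ⟨h1, rfl⟩
        exact h (hsurj t (Finset.mem_filter.1 (hP ht)).1 b h1)

/-- A finite graph with an edge and no leaf contains a cycle. -/
theorem exists_isCycle_of_no_leaf {W : Type*} [Finite W] (G : SimpleGraph W) {a b : W}
    (hab : G.Adj a b) (hG : ∀ x y, G.Adj x y → ∃ z, z ≠ y ∧ G.Adj x z) :
    ∃ (u : W) (p : G.Walk u u), p.IsCycle := by
  by_contra! hac
  have hac : G.IsAcyclic := fun {u} p => hac u p
  have hfin := Fintype.ofFinite W
  let S : Set ℕ := {k | ∃ (u v : W) (p : G.Walk u v), p.IsPath ∧ p.length = k}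
  have hS : S.Finite := by
    refine (Set.finite_Iio (Fintype.card W)).subset ?_
    rintro _ ⟨u, v, p, hp, rfl⟩
    exact hp.length_lt
  have h1 : 1 ∈ S := ⟨a, b, SimpleGraph.Walk.cons hab .nil, by simp [hab.ne], by simp⟩
  obtain ⟨k, ⟨u, v, p, hp, rfl⟩, hmax⟩ := Set.exists_max_image S id hS ⟨1, h1⟩
  have hlen : 1 ≤ p.length := hmax 1 h1
  have hnil : ¬ p.Nil := by
    rw [← SimpleGraph.Walk.length_eq_zero_iff]
    omega
  obtain ⟨z, hz, huz⟩ := hG u p.snd (p.adj_snd hnil)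
  have hzp : z ∉ p.support := fun h => hz (hac.eq_snd_of_adj_start hp huz h)
  have := hmax (p.length + 1) ⟨z, v, SimpleGraph.Walk.cons huz.symm p, by
    simp [SimpleGraph.Walk.cons_isPath_iff, hp, hzp], by simp⟩
  simp at this

/-- If all edges lie in an even number of triangles and the link of `v` is minimal among nonempty
even graphs, then the triangles around `v` are arranged cyclically. -/
theorem exists_cyclic_link {ι W : Type*} [Finite W] [DecidableEq W] (T : Finset ι)
    (τ : ι → Finset W) (hτ : Set.InjOn τ T) (hcard : ∀ t ∈ T, (τ t).card = 3)
    (heven : ∀ a b, a ≠ b → Even (T.filter fun t => a ∈ τ t ∧ b ∈ τ t).card) (v : W)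
    (hv : ∃ t ∈ T, v ∈ τ t)
    (hmin : ∀ P ⊆ T.filter (fun t => v ∈ τ t), P.Nonempty →
      (∀ b, b ≠ v → Even (P.filter fun t => b ∈ τ t).card) → P = T.filter (fun t => v ∈ τ t)) :
    ∃ (n : ℕ) (w : ℕ → W), 3 ≤ n ∧ w n = w 0 ∧ Set.InjOn w (Set.Iio n) ∧ (∀ i, w i ≠ v) ∧
      (∀ t ∈ T, v ∈ τ t → ∃ i < n, τ t = {v, w i, w (i + 1)}) ∧
      ∀ i < n, ∃ t ∈ T, τ t = {v, w i, w (i + 1)} := by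
  let G : SimpleGraph W :=
    { Adj := fun a b => a ≠ b ∧ a ≠ v ∧ b ≠ v ∧ ∃ t ∈ T, τ t = {v, a, b}
      symm := ⟨by
        rintro a b ⟨h1, h2, h3, t, ht, h⟩
        exact ⟨h1.symm, h3, h2, t, ht, by rw [h, Finset.pair_comm]⟩⟩
      loopless := ⟨fun a h => h.1 rfl⟩ }
  have hdecomp : ∀ t ∈ T, ∀ a ∈ τ t, v ∈ τ t → a ≠ v → ∃ b, G.Adj a b ∧ τ t = {v, a, b} := by
    intro t ht a ha hvt hav
    obtain ⟨b, hb⟩ : ∃ b, ((τ t).erase v).erase a = {b} := by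
      rw [← Finset.card_eq_one, Finset.card_erase_of_mem (Finset.mem_erase.2 ⟨hav, ha⟩),
        Finset.card_erase_of_mem hvt, hcard t ht]
    have hb' : b ∈ ((τ t).erase v).erase a := by simp [hb]
    simp only [Finset.mem_erase] at hb'
    have h : τ t = {v, a, b} := by
      rw [← hb, Finset.insert_erase (Finset.mem_erase.2 ⟨hav, ha⟩), Finset.insert_erase hvt]
    exact ⟨b, ⟨hb'.1.symm, hav, hb'.2.1, t, ht, h⟩, h⟩
  have hleaf : ∀ x y, G.Adj x y → ∃ z, z ≠ y ∧ G.Adj x z := by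
    rintro x y ⟨hxy, hxv, hyv, t, ht, h⟩
    have hmem : t ∈ T.filter fun t => v ∈ τ t ∧ x ∈ τ t := by simp [ht, h]
    have hgt : 1 < (T.filter fun t => v ∈ τ t ∧ x ∈ τ t).card := by
      obtain ⟨k, hk⟩ := heven v x hxv.symm
      have := Finset.card_pos.2 ⟨t, hmem⟩
      omega
    obtain ⟨s, hs, hst⟩ := Finset.exists_mem_ne hgt t
    rw [Finset.mem_filter] at hs
    obtain ⟨z, hxz, hsz⟩ := hdecomp s hs.1 x hs.2.2 hs.2.1 hxv
    refine ⟨z, ?_, hxz⟩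
    rintro rfl
    exact hst (hτ hs.1 ht (hsz.trans h.symm))
  obtain ⟨t₀, ht₀, hvt₀⟩ := hv
  obtain ⟨a₀, ha₀, ha₀v⟩ : ∃ a ∈ τ t₀, a ≠ v :=
    Finset.exists_mem_ne (by rw [hcard t₀ ht₀]; omega) v
  obtain ⟨b₀, hab₀, -⟩ := hdecomp t₀ ht₀ a₀ ha₀ hvt₀ ha₀v
  obtain ⟨u, p, hp⟩ := exists_isCycle_of_no_leaf G hab₀ hleaf
  have hadj : ∀ i < p.length, G.Adj (p.getVert i) (p.getVert (i + 1)) := fun i hi =>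
    p.adj_getVert_succ hi
  have hne : ∀ i, p.getVert i ≠ v := by
    intro i
    by_cases hi : i < p.length
    · exact (hadj i hi).2.1
    · rw [p.getVert_of_length_le (not_lt.1 hi), ← p.getVert_zero]
      exact (hadj 0 (by have := hp.three_le_length; omega)).2.1
  let P : Finset ι := T.filter fun t => ∃ e ∈ p.edges, τ t = insert v e.toFinset
  have hedge : ∀ e ∈ p.edges, v ∉ e ∧ ∃ t ∈ T, τ t = insert v e.toFinset := by
    intro e he
    induction e using Sym2.ind with
    | _ a b =>
      obtain ⟨-, h1, h2, t, ht, h⟩ := p.adj_of_mem_edges he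
      refine ⟨by simp [h1.symm, h2.symm], t, ht, ?_⟩
      rw [h, Sym2.toFinset_mk_eq]
  have hPeq : P = T.filter (fun t => v ∈ τ t) := by
    refine hmin P ?_ ?_ ?_
    · intro t ht
      obtain ⟨h1, e, -, h2⟩ := Finset.mem_filter.1 ht
      simp [h1, h2]
    · obtain ⟨t, ht, h⟩ := (hedge s(p.getVert 0, p.getVert 1)
        (by
          rw [p.mk_mem_edges_iff_exists]
          exact ⟨0, by have := hp.three_le_length; omega, rfl⟩)).2
      refine ⟨t, Finset.mem_filter.2 ⟨ht, _, ?_, h⟩⟩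
      rw [p.mk_mem_edges_iff_exists]
      exact ⟨0, by have := hp.three_le_length; omega, rfl⟩
    · intro b hb
      have hcount := (hp.isTrail.even_countP_edges_iff b).2 (fun h => absurd rfl h)
      rw [List.countP_eq_length_filter,
        ← List.toFinset_card_of_nodup (hp.isTrail.edges_nodup.filter _)] at hcount
      convert hcount using 1
      refine Finset.card_bij (fun t ht => ?_) ?_ ?_ ?_
      · exact (Finset.mem_filter.1 (Finset.mem_filter.1 ht).1).2.choose
      · intro t ht
        have h := (Finset.mem_filter.1 (Finset.mem_filter.1 ht).1).2.choose_spec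
        have hbt := (Finset.mem_filter.1 ht).2
        rw [h.2, Finset.mem_insert, Sym2.mem_toFinset] at hbt
        simpa [h.1] using hbt.resolve_left hb
      · intro t ht s hs hts
        have h := (Finset.mem_filter.1 (Finset.mem_filter.1 ht).1).2.choose_spec
        have h' := (Finset.mem_filter.1 (Finset.mem_filter.1 hs).1).2.choose_spec
        refine hτ (Finset.mem_filter.1 (Finset.mem_filter.1 ht).1).1
          (Finset.mem_filter.1 (Finset.mem_filter.1 hs).1).1 ?_
        rw [h.2, h'.2, hts]
      · intro e he
        simp only [List.mem_toFinset, List.mem_filter, decide_eq_true_eq] at he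
        obtain ⟨hve, t, ht, h⟩ := hedge e he.1
        have htP : t ∈ P := Finset.mem_filter.2 ⟨ht, e, he.1, h⟩
        refine ⟨t, Finset.mem_filter.2 ⟨htP, by simp [h, he.2]⟩, ?_⟩
        have h' := (Finset.mem_filter.1 htP).2.choose_spec
        have hve' := (hedge _ h'.1).1
        have := h'.2.symm.trans h
        ext x
        by_cases hx : x = v
        · subst hx
          exact ⟨fun hx => (hve' hx).elim, fun hx => (hve hx).elim⟩
        · simpa [hx] using Finset.ext_iff.1 this x
  refine ⟨p.length, p.getVert, hp.three_le_length, ?_, ?_, hne, ?_, ?_⟩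
  · rw [p.getVert_length, p.getVert_zero]
  · refine hp.getVert_injOn'.mono ?_
    intro i hi
    have : i < p.length := hi
    simp only [Set.mem_ofPred_eq]
    omega
  · intro t ht hvt
    have htP : t ∈ P := by rw [hPeq]; simp [ht, hvt]
    obtain ⟨-, e, he, h⟩ := Finset.mem_filter.1 htP
    induction e using Sym2.ind with
    | _ a b =>
      obtain ⟨i, hi, h'⟩ := p.mk_mem_edges_iff_exists.1 he
      exact ⟨i, hi, by rw [h, ← h', Sym2.toFinset_mk_eq]⟩
  · intro i hi
    exact (hadj i hi).2.2.2

/-- A complete planar fan with `n ≥ 3` rays `u i` together with its continuous piecewise linear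
cone coordinates `y i`. -/
theorem exists_planar_fan {n : ℕ} (hn : 3 ≤ n) :
    ∃ (u : ℕ → ℝ × ℝ) (y : ℕ → ℝ × ℝ → ℝ), u n = u 0 ∧ (∀ j, Continuous (y j)) ∧
      (∀ z, ∃ i < n, ∃ s t : ℝ, 0 ≤ s ∧ 0 ≤ t ∧ z = s • u i + t • u (i + 1)) ∧
      ∀ i < n, ∀ s t : ℝ, 0 ≤ s → 0 ≤ t → ∀ j < n, y j (s • u i + t • u (i + 1)) =
        (if j = i then s else 0) + (if j = (i + 1) % n then t else 0) := by
  obtain ⟨M, rfl⟩ : ∃ M, n = M + 2 := ⟨n - 2, by omega⟩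
  have hM : 1 ≤ M := by omega
  have hM' : (1 : ℝ) ≤ M := by exact_mod_cast hM
  have hM0 : (0 : ℝ) < M := by linarith
  let u : ℕ → ℝ × ℝ := fun i =>
    if i ≤ M then ((M : ℝ) - i, (i : ℝ)) else if i = M + 1 then (-1, -1) else ((M : ℝ), 0)
  let d : ℝ × ℝ → ℝ := fun z => max 0 (max (-z.1) (-z.2))
  let y : ℕ → ℝ × ℝ → ℝ := fun j z => if j = M + 1 then d z else
    max 0 ((z.1 + d z) + (z.2 + d z) - |j * ((z.1 + d z) + (z.2 + d z)) - M * (z.2 + d z)|) / M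
  have hu1 : ∀ i ≤ M, u i = ((M : ℝ) - i, (i : ℝ)) := fun i hi => by simp [u, hi]
  have hu2 : u (M + 1) = (-1, -1) := by simp [u]
  have hu3 : u (M + 2) = ((M : ℝ), 0) := by simp [u]
  have hd : Continuous d := by fun_prop
  refine ⟨u, y, ?_, ?_, ?_, ?_⟩
  · rw [hu3, hu1 0 (by omega)]; simp
  · intro j
    by_cases h : j = M + 1
    · simpa only [y, h, if_true] using hd
    · simp only [y, h, if_false]
      fun_prop
  · rintro ⟨a, b⟩
    by_cases hneg : a < 0 ∨ b < 0
    · by_cases hab : a ≤ b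
      · refine ⟨M, by omega, (b - a) / M, -a, div_nonneg (by linarith) hM0.le, ?_, ?_⟩
        · rcases hneg with h | h <;> linarith
        · rw [hu1 M le_rfl, hu2]
          ext <;> simp
          field_simp
          ring
      · refine ⟨M + 1, by omega, -b, (a - b) / M, ?_, div_nonneg (by linarith) hM0.le, ?_⟩
        · rcases hneg with h | h <;> linarith
        · rw [hu3, hu2]
          ext <;> simp
          field_simp
          ring
    · push Not at hneg
      obtain ⟨ha, hb⟩ := hneg
      by_cases hb0 : a = 0
      · refine ⟨M, by omega, b / M, 0, by positivity, le_rfl, ?_⟩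
        rw [hu1 M le_rfl, hb0]
        ext <;> simp
        field_simp
      have ha' : 0 < a := lt_of_le_of_ne ha (Ne.symm hb0)
      have hs : 0 < a + b := by linarith
      set q : ℝ := M * b / (a + b) with hq
      have hq0 : 0 ≤ q := by positivity
      have hqM : q < M := by
        rw [hq, div_lt_iff₀ hs]
        nlinarith
      have hfl : ⌊q⌋₊ < M := (Nat.floor_lt hq0).2 hqM
      have h1 := Nat.floor_le hq0
      have h2 := Nat.lt_floor_add_one q
      have hqe : q * (a + b) = M * b := by rw [hq]; field_simp
      refine ⟨⌊q⌋₊, by omega, (a + b) / M * (⌊q⌋₊ + 1 - q), (a + b) / M * (q - ⌊q⌋₊),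
        mul_nonneg (by positivity) (by linarith), mul_nonneg (by positivity) (by linarith), ?_⟩
      rw [hu1 _ hfl.le, hu1 _ hfl]
      generalize (⌊q⌋₊ : ℕ) = k at *
      clear_value q
      ext <;> simp <;> field_simp
      · linear_combination hqe
      · linear_combination -hqe
  · intro i hi s t hs ht j hj
    rcases lt_trichotomy i M with h | h | h
    · have hz : s • u i + t • u (i + 1) = (s * (M - i) + t * (M - (i + 1)), s * i + t * (i + 1)) := by
        rw [hu1 i h.le, hu1 (i + 1) h]
        ext <;> simp
      have hiM : (i : ℝ) + 1 ≤ M := by exact_mod_cast h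
      have hi0 : (0 : ℝ) ≤ i := by positivity
      have hd0 : d (s * (M - i) + t * (M - (i + 1)), s * i + t * (i + 1)) = 0 := by
        simp only [d]
        rw [max_eq_left]
        have := mul_nonneg hs (show (0 : ℝ) ≤ M - i by linarith)
        have := mul_nonneg ht (show (0 : ℝ) ≤ M - (i + 1) by linarith)
        exact max_le (by linarith) (by nlinarith)
      rw [hz, Nat.mod_eq_of_lt (by omega)]
      by_cases hj1 : j = M + 1
      · simp only [y, hj1, if_true, hd0]
        rw [if_neg (by omega), if_neg (by omega), add_zero]
      · simp only [y, hj1, if_false, hd0, add_zero]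
        have e : s * (M - i) + t * (M - (i + 1)) + (s * i + t * (i + 1))
            - |j * (s * (M - i) + t * (M - (i + 1)) + (s * i + t * (i + 1)))
              - M * (s * i + t * (i + 1))| = ((s + t) - |(j - i) * (s + t) - t|) * M := by
          have : (j : ℝ) * (s * (M - i) + t * (M - (i + 1)) + (s * i + t * (i + 1)))
              - M * (s * i + t * (i + 1)) = ((j - i) * (s + t) - t) * M := by ring
          rw [this, abs_mul, abs_of_pos hM0]
          ring
        rw [e]
        rcases lt_trichotomy j i with hji | hji | hji
        · have hji' : (j : ℝ) + 1 ≤ i := by exact_mod_cast hji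
          rw [if_neg (by omega), if_neg (by omega), max_eq_left]
          · simp
          · have : ((j : ℝ) - i) * (s + t) ≤ -(s + t) := by nlinarith
            have := neg_abs_le (((j : ℝ) - i) * (s + t) - t)
            exact mul_nonpos_of_nonpos_of_nonneg (by linarith) hM0.le
        · subst hji
          rw [if_pos rfl, if_neg (by omega)]
          have : ((s + t) - |((j : ℝ) - j) * (s + t) - t|) = s := by
            rw [sub_self, zero_mul, zero_sub, abs_neg, abs_of_nonneg ht]; ring
          rw [this, max_eq_right (by positivity)]
          field_simp
          ring
        · by_cases hji2 : j = i + 1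
          · subst hji2
            rw [if_neg (by omega), if_pos rfl]
            have : ((s + t) - |(((i + 1 : ℕ) : ℝ) - i) * (s + t) - t|) = t := by
              push_cast
              rw [show ((i : ℝ) + 1 - i) * (s + t) - t = s by ring, abs_of_nonneg hs]; ring
            rw [this, max_eq_right (by positivity)]
            field_simp
            ring
          · have hji' : (i : ℝ) + 2 ≤ j := by exact_mod_cast (show i + 2 ≤ j by omega)
            rw [if_neg (by omega), if_neg (by omega), max_eq_left]
            · simp
            · have : 2 * (s + t) ≤ ((j : ℝ) - i) * (s + t) := by nlinarith
              have := le_abs_self (((j : ℝ) - i) * (s + t) - t)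
              exact mul_nonpos_of_nonpos_of_nonneg (by linarith) hM0.le
    · subst h
      have hz : s • u i + t • u (i + 1) = (-t, s * i - t) := by
        rw [hu1 i le_rfl, hu2]
        ext <;> simp
        ring
      have hd0 : d (-t, s * i - t) = t := by
        simp only [d]
        have : 0 ≤ s * i := by positivity
        rw [max_eq_right, max_eq_left] <;> simp <;> grind
      rw [hz, Nat.mod_eq_of_lt (by omega)]
      by_cases hj1 : j = i + 1
      · simp [y, hj1, hd0]
      · have hji : (j : ℝ) ≤ i := by exact_mod_cast (show j ≤ i by omega)
        simp only [y, hj1, if_false, hd0]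
        have e : -t + t + (s * i - t + t) - |j * (-t + t + (s * i - t + t)) - i * (s * i - t + t)|
            = (s - (i - j) * s) * i := by
          rw [show j * (-t + t + (s * i - t + t)) - i * (s * i - t + t) = -((i - j) * s * i) by ring,
            abs_neg, abs_of_nonneg (by have : (0 : ℝ) ≤ i - j := by linarith
                                       positivity)]
          ring
        rw [e]
        by_cases hji : j = i
        · subst hji
          simp only [sub_self, zero_mul, sub_zero, if_true]
          rw [max_eq_right (by positivity)]
          field_simp
          simp
        · have hji' : (j : ℝ) + 1 ≤ i := by exact_mod_cast (show j + 1 ≤ i by omega)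
          rw [if_neg hji, max_eq_left]
          · simp
          · exact mul_nonpos_of_nonpos_of_nonneg (by nlinarith) hM0.le
    · obtain rfl : i = M + 1 := by omega
      have hz : s • u (M + 1) + t • u (M + 1 + 1) = (t * M - s, -s) := by
        rw [hu2, hu3]
        ext <;> simp
        ring
      have hd0 : d (t * M - s, -s) = s := by
        simp only [d]
        have : 0 ≤ t * M := by positivity
        rw [max_eq_right, max_eq_right] <;> simp <;> grind
      rw [hz, show (M + 1 + 1) % (M + 2) = 0 from Nat.mod_self _]
      by_cases hj1 : j = M + 1
      · simp [y, hj1, hd0]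
      · simp only [y, hj1, if_false, hd0]
        have e : t * M - s + s + (-s + s) - |j * (t * M - s + s + (-s + s)) - M * (-s + s)|
            = (t - j * t) * M := by
          rw [show j * (t * M - s + s + (-s + s)) - M * (-s + s) = j * t * M by ring,
            abs_of_nonneg (by positivity)]
          ring
        rw [e]
        by_cases hj0 : j = 0
        · subst hj0
          simp only [Nat.cast_zero, zero_mul, sub_zero, if_true]
          rw [max_eq_right (by positivity)]
          field_simp
          simp
        · have hji' : (1 : ℝ) ≤ j := by exact_mod_cast (show 1 ≤ j by omega)
          rw [if_neg hj0, max_eq_left]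
          · simp
          · exact mul_nonpos_of_nonpos_of_nonneg (by nlinarith) hM0.le

/-- The abstract simplicial complex generated by a family of finite sets. -/
def generatedComplex {W : Type*} (F : Finset (Finset W)) : PreAbstractSimplicialComplex W where
  faces := {r | r.Nonempty ∧ ∃ t ∈ F, r ⊆ t}
  isRelLowerSet_faces := by
    rintro r ⟨hr, t, ht, hrt⟩
    exact ⟨hr, fun s hsr hs => ⟨hs, t, ht, hsr.trans hrt⟩⟩

/-- The geometric realization in Euclidean space, on the standard basis vectors, of the simplicial
complex generated by `F`. -/
def standardRealization {N : ℕ} (F : Finset (Finset (Fin N))) :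
    Geometry.SimplicialComplex ℝ (EuclideanSpace ℝ (Fin N)) :=
  Geometry.SimplicialComplex.ofAffineIndependent
    ((generatedComplex F).map fun i => EuclideanSpace.single i (1 : ℝ)) <| by
      have h : AffineIndependent ℝ fun i : Fin N => EuclideanSpace.single i (1 : ℝ) := by
        have hb : (fun i : Fin N => EuclideanSpace.single i (1 : ℝ)) =
            (EuclideanSpace.basisFun (Fin N) ℝ).toBasis := by
          funext i
          simp
        rw [hb]
        exact (EuclideanSpace.basisFun (Fin N) ℝ).toBasis.linearIndependent.affineIndependent
      refine h.range.mono fun x hx => ?_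
      simp only [Set.mem_iUnion, Finset.mem_coe] at hx
      obtain ⟨_, ⟨r, _, rfl⟩, hx⟩ := hx
      obtain ⟨i, -, rfl⟩ := Finset.mem_image.1 hx
      exact ⟨i, rfl⟩

theorem mem_standardRealization_faces {N : ℕ} {F : Finset (Finset (Fin N))}
    {s : Finset (EuclideanSpace ℝ (Fin N))} :
    s ∈ (standardRealization F).faces ↔ ∃ r : Finset (Fin N), (r.Nonempty ∧ ∃ t ∈ F, r ⊆ t) ∧
      r.image (fun i => EuclideanSpace.single i (1 : ℝ)) = s :=
  Iff.rfl

theorem standardRealization_faces_finite {N : ℕ} (F : Finset (Finset (Fin N))) :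
    (standardRealization F).faces.Finite :=
  (Set.toFinite {r : Finset (Fin N) | r.Nonempty ∧ ∃ t ∈ F, r ⊆ t}).image _

theorem mem_standardRealization_space {N : ℕ} {F : Finset (Finset (Fin N))}
    {x : EuclideanSpace ℝ (Fin N)} :
    x ∈ (standardRealization F).space ↔
      (∀ i, 0 ≤ x i) ∧ ∑ i, x i = 1 ∧ ∃ t ∈ F, ∀ i, x i ≠ 0 → i ∈ t := by
  rw [Geometry.SimplicialComplex.mem_space_iff]
  constructor
  · rintro ⟨_, ⟨r, ⟨hr, t, ht, hrt⟩, rfl⟩, hx⟩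
    have hconv : Convex ℝ {x : EuclideanSpace ℝ (Fin N) |
        (∀ i, 0 ≤ x i) ∧ ∑ i, x i = 1 ∧ ∀ i, i ∉ t → x i = 0} := by
      rintro x ⟨hx1, hx2, hx3⟩ y ⟨hy1, hy2, hy3⟩ a b ha hb hab
      refine ⟨fun i => ?_, ?_, fun i hi => ?_⟩
      · have := hx1 i
        have := hy1 i
        simp only [PiLp.add_apply, PiLp.smul_apply, smul_eq_mul]
        positivity
      · simp only [PiLp.add_apply, PiLp.smul_apply, smul_eq_mul, Finset.sum_add_distrib,
          ← Finset.mul_sum, hx2, hy2]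
        linarith
      · simp [hx3 i hi, hy3 i hi]
    have h := convexHull_min (fun y hy => ?_) hconv hx
    · obtain ⟨h1, h2, h3⟩ := h
      exact ⟨h1, h2, t, ht, fun i hi => by_contra fun hit => hi (h3 i hit)⟩
    · obtain ⟨i, hi, rfl⟩ := Finset.mem_image.1 (Finset.mem_coe.1 hy)
      refine ⟨fun j => ?_, by simp, fun j hj => ?_⟩
      · simp only [PiLp.single_apply]
        split_ifs <;> norm_num
      · have : j ≠ i := fun h => hj (h ▸ hrt hi)
        simp [this]
  · rintro ⟨h1, h2, t, ht, h3⟩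
    have hsum : ∑ i ∈ t, x i = 1 := by
      rw [← h2]
      exact Finset.sum_subset (Finset.subset_univ t) fun i _ hi =>
        by_contra fun h => hi (h3 i h)
    have hne : t.Nonempty := by
      rw [Finset.nonempty_iff_ne_empty]
      rintro rfl
      simp at hsum
    refine ⟨_, ⟨t, ⟨hne, t, ht, subset_rfl⟩, rfl⟩, ?_⟩
    have hx : x = ∑ i ∈ t, x i • EuclideanSpace.single i (1 : ℝ) := by
      ext j
      simp only [WithLp.ofLp_sum, Finset.sum_apply, PiLp.smul_apply, PiLp.single_apply,
        smul_eq_mul, mul_ite, mul_one, mul_zero, Finset.sum_ite_eq]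
      split_ifs with h
      · rfl
      · exact by_contra fun h' => h (h3 j h')
    rw [hx]
    exact (convex_convexHull ℝ _).sum_mem (fun i _ => h1 i) hsum fun i hi =>
      subset_convexHull ℝ _ (Finset.mem_coe.2 (Finset.mem_image_of_mem _ hi))

theorem compactSpace_standardRealization {N : ℕ} (F : Finset (Finset (Fin N))) :
    CompactSpace (standardRealization F).space :=
  isCompact_iff_compactSpace.1 <| (standardRealization_faces_finite F).isCompact_biUnion fun s _ =>
    s.finite_toSet.isCompact_convexHull (𝕜 := ℝ)

theorem sum_range_two_adjacent {M : Type*} [AddCommGroup M] [Module ℝ M] {n : ℕ} (c : ℕ → M)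
    (hc : c n = c 0) {i : ℕ} (hi : i < n) (s t : ℝ) (y : ℕ → ℝ)
    (hy : ∀ j < n, y j = (if j = i then s else 0) + (if j = (i + 1) % n then t else 0)) :
    ∑ j ∈ Finset.range n, y j • c j = s • c i + t • c (i + 1) := by
  have hmod : c ((i + 1) % n) = c (i + 1) := by
    rcases (show i + 1 ≤ n from hi).lt_or_eq with h | h
    · rw [Nat.mod_eq_of_lt h]
    · rw [h, Nat.mod_self, hc]
  have hlt : (i + 1) % n < n := Nat.mod_lt _ (by omega)
  rw [Finset.sum_congr rfl fun j hj => by rw [hy j (Finset.mem_range.1 hj)]]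
  simp [add_smul, ite_smul, Finset.sum_add_distrib, hi, hlt, hmod]

/-- The open star of a vertex whose link is a polygon is homeomorphic to the plane. -/
theorem exists_openStar_chart {N : ℕ} (F : Finset (Finset (Fin N))) (v : Fin N) {n : ℕ}
    (hn : 3 ≤ n) (w : ℕ → Fin N) (hw0 : w n = w 0) (hw : Set.InjOn w (Set.Iio n))
    (hwv : ∀ i, w i ≠ v) (hF : ∀ t ∈ F, v ∈ t → ∃ i < n, t = {v, w i, w (i + 1)})
    (hF' : ∀ i < n, ({v, w i, w (i + 1)} : Finset (Fin N)) ∈ F) :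
    ∃ φ : OpenPartialHomeomorph (standardRealization F).space (ℝ × ℝ),
      φ.source = {x | x.1 v ≠ 0} := by
  obtain ⟨u, y, hu, hyc, hsurj, hy⟩ := exists_planar_fan hn
  let e : Fin N → EuclideanSpace ℝ (Fin N) := fun i => EuclideanSpace.single i 1
  let pt : ℕ → ℝ → ℝ → ℝ → EuclideanSpace ℝ (Fin N) := fun i a p q =>
    a • e v + (p • e (w i) + q • e (w (i + 1)))
  let f : EuclideanSpace ℝ (Fin N) → ℝ × ℝ := fun x =>
    (x v)⁻¹ • ∑ j ∈ Finset.range n, x (w j) • u j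
  let g : ℝ × ℝ → EuclideanSpace ℝ (Fin N) := fun z =>
    (1 + ∑ j ∈ Finset.range n, y j z)⁻¹ • (e v + ∑ j ∈ Finset.range n, y j z • e (w j))
  have hwmod : ∀ i < n, w ((i + 1) % n) = w (i + 1) := by
    intro i hi
    rcases (show i + 1 ≤ n from hi).lt_or_eq with h | h
    · rw [Nat.mod_eq_of_lt h]
    · rw [h, Nat.mod_self, hw0]
  have hmodlt : ∀ i, (i + 1) % n < n := fun i => Nat.mod_lt _ (by omega)
  have hw_succ : ∀ i < n, w i ≠ w (i + 1) := by
    intro i hi h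
    rw [← hwmod i hi] at h
    have h' := hw hi (hmodlt i) h
    rcases (show i + 1 ≤ n from hi).lt_or_eq with h1 | h1
    · rw [Nat.mod_eq_of_lt h1] at h'
      omega
    · rw [h1, Nat.mod_self] at h'
      omega
  have pt_v : ∀ i a p q, pt i a p q v = a := by
    intro i a p q
    simp [pt, e, (hwv _).symm]
  have pt_w : ∀ i < n, ∀ a p q, ∀ j < n, pt i a p q (w j) =
      (if j = i then p else 0) + (if j = (i + 1) % n then q else 0) := by
    intro i hi a p q j hj
    have h1 : w j = w i ↔ j = i := hw.eq_iff hj hi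
    have h2 : w j = w (i + 1) ↔ j = (i + 1) % n := by
      rw [← hwmod i hi]
      exact hw.eq_iff hj (hmodlt i)
    simp [pt, e, hwv, h1, h2]
  have f_pt : ∀ i < n, ∀ a p q, f (pt i a p q) = (a⁻¹ * p) • u i + (a⁻¹ * q) • u (i + 1) := by
    intro i hi a p q
    simp only [f, pt_v]
    rw [sum_range_two_adjacent u hu hi p q _ (pt_w i hi a p q), smul_add, smul_smul, smul_smul]
  have g_fan : ∀ i < n, ∀ s t : ℝ, 0 ≤ s → 0 ≤ t → g (s • u i + t • u (i + 1)) =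
      pt i (1 + (s + t))⁻¹ ((1 + (s + t))⁻¹ * s) ((1 + (s + t))⁻¹ * t) := by
    intro i hi s t hs ht
    have h1 := sum_range_two_adjacent (fun j => e (w j)) (by simp [hw0]) hi s t _
      (hy i hi s t hs ht)
    have h2 := sum_range_two_adjacent (fun _ => (1 : ℝ)) rfl hi s t _ (hy i hi s t hs ht)
    simp only [smul_eq_mul, mul_one] at h2
    simp only [g, h1, h2, pt, smul_add, smul_smul]
  have hspace : ∀ x ∈ (standardRealization F).space, x v ≠ 0 → ∃ i < n, ∃ p q : ℝ,
      0 < x v ∧ 0 ≤ p ∧ 0 ≤ q ∧ x v + (p + q) = 1 ∧ x = pt i (x v) p q := by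
    intro x hx hxv
    obtain ⟨h1, h2, t, ht, h3⟩ := mem_standardRealization_space.1 hx
    obtain ⟨i, hi, rfl⟩ := hF t ht (h3 v hxv)
    have hx' : x = pt i (x v) (x (w i)) (x (w (i + 1))) := by
      ext k
      simp only [pt, e, PiLp.add_apply, PiLp.smul_apply, PiLp.single_apply, smul_eq_mul, mul_ite,
        mul_one, mul_zero]
      by_cases hk : x k = 0
      · rw [hk]
        split_ifs <;> simp_all
      · have := h3 k hk
        simp only [Finset.mem_insert, Finset.mem_singleton] at this
        rcases this with rfl | rfl | rfl
        · simp [(hwv _).symm]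
        · simp [hwv, hw_succ i hi]
        · simp [hwv, (hw_succ i hi).symm]
    refine ⟨i, hi, _, _, lt_of_le_of_ne (h1 v) hxv.symm, h1 _, h1 _, ?_, hx'⟩
    have hsub := Finset.sum_subset (Finset.subset_univ {v, w i, w (i + 1)}) (f := fun k => x k)
      fun k _ hk => by_contra fun h => hk (h3 k h)
    rw [← h2, ← hsub, Finset.sum_insert (by simp [(hwv _).symm]),
      Finset.sum_pair (hw_succ i hi)]
  have g_mem : ∀ z, g z ∈ (standardRealization F).space := by
    intro z
    obtain ⟨i, hi, s, t, hs, ht, rfl⟩ := hsurj z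
    rw [g_fan i hi s t hs ht, mem_standardRealization_space]
    have hpos : 0 < 1 + (s + t) := by positivity
    refine ⟨fun k => ?_, ?_, _, hF' i hi, fun k hk => ?_⟩
    · simp only [pt, e, PiLp.add_apply, PiLp.smul_apply, PiLp.single_apply, smul_eq_mul]
      have h : ∀ (P : Prop) [Decidable P], (0 : ℝ) ≤ if P then 1 else 0 := by
        intro P _
        split_ifs <;> norm_num
      have := h (k = v)
      have := h (k = w i)
      have := h (k = w (i + 1))
      positivity
    · simp only [pt, e, PiLp.add_apply, PiLp.smul_apply, PiLp.single_apply, smul_eq_mul, mul_ite,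
        mul_one, mul_zero, Finset.sum_add_distrib, Finset.sum_ite_eq', Finset.mem_univ, if_true]
      field_simp
    · by_contra h
      simp only [Finset.mem_insert, Finset.mem_singleton, not_or] at h
      exact hk (by simp [pt, e, h.1, h.2.1, h.2.2])
  have gf : ∀ x ∈ (standardRealization F).space, x v ≠ 0 → g (f x) = x := by
    intro x hx hxv
    obtain ⟨i, hi, p, q, h0, hp, hq, h1, h⟩ := hspace x hx hxv
    generalize x v = a at *
    subst h
    rw [f_pt i hi, g_fan i hi _ _ (by positivity) (by positivity)]
    have : (1 + (a⁻¹ * p + a⁻¹ * q))⁻¹ = a := by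
      rw [← mul_add, show p + q = 1 - a by linarith]
      field_simp
      ring
    rw [this, mul_inv_cancel_left₀ hxv, mul_inv_cancel_left₀ hxv]
  have fg : ∀ z, f (g z) = z ∧ g z v ≠ 0 ∧ 1 + ∑ j ∈ Finset.range n, y j z ≠ 0 := by
    intro z
    obtain ⟨i, hi, s, t, hs, ht, rfl⟩ := hsurj z
    have hpos : 0 < 1 + (s + t) := by positivity
    have h2 := sum_range_two_adjacent (fun _ => (1 : ℝ)) rfl hi s t _ (hy i hi s t hs ht)
    simp only [smul_eq_mul, mul_one] at h2
    rw [g_fan i hi s t hs ht, f_pt i hi, pt_v, h2, inv_inv, mul_inv_cancel_left₀ hpos.ne',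
      mul_inv_cancel_left₀ hpos.ne']
    exact ⟨rfl, by positivity, hpos.ne'⟩
  have hcoord : ∀ k, Continuous fun x : (standardRealization F).space => x.1 k := by
    intro k
    fun_prop
  refine ⟨{ toFun := fun x => f x.1
            invFun := fun z => ⟨g z, g_mem z⟩
            source := {x | x.1 v ≠ 0}
            target := Set.univ
            map_source' := fun _ _ => Set.mem_univ _
            map_target' := fun z _ => (fg z).2.1
            left_inv' := fun x hx => Subtype.ext (gf x.1 x.2 hx)
            right_inv' := fun z _ => (fg z).1
            open_source := (hcoord v).isOpen_preimage _ isOpen_compl_singleton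
            open_target := isOpen_univ
            continuousOn_toFun := ?_
            continuousOn_invFun := ?_ }, rfl⟩
  · refine ((hcoord v).continuousOn.inv₀ fun x hx => hx).smul (Continuous.continuousOn ?_)
    exact continuous_finsetSum _ fun j _ => (hcoord (w j)).smul continuous_const
  · refine (Continuous.subtype_mk ?_ _).continuousOn
    refine Continuous.smul (Continuous.inv₀ ?_ fun z => (fg z).2.2) ?_
    · exact continuous_const.add (continuous_finsetSum _ fun j _ => hyc j)
    · exact continuous_const.add (continuous_finsetSum _ fun j _ => (hyc j).smul continuous_const)

/-- A family of triangles with polygonal vertex links triangulates a surface. -/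
theorem nonempty_chartedSpace_standardRealization {N : ℕ} (F : Finset (Finset (Fin N)))
    (hF : ∀ v, (∃ t ∈ F, v ∈ t) → ∃ (n : ℕ) (w : ℕ → Fin N), 3 ≤ n ∧ w n = w 0 ∧
      Set.InjOn w (Set.Iio n) ∧ (∀ i, w i ≠ v) ∧
      (∀ t ∈ F, v ∈ t → ∃ i < n, t = {v, w i, w (i + 1)}) ∧
      ∀ i < n, ({v, w i, w (i + 1)} : Finset (Fin N)) ∈ F) :
    Nonempty (ChartedSpace (EuclideanSpace ℝ (Fin 2)) (standardRealization F).space) := by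
  have key : ∀ x : (standardRealization F).space,
      ∃ φ : OpenPartialHomeomorph (standardRealization F).space (EuclideanSpace ℝ (Fin 2)),
        x ∈ φ.source := by
    intro x
    obtain ⟨h1, h2, t, ht, h3⟩ := mem_standardRealization_space.1 x.2
    obtain ⟨v, -, hv⟩ := Finset.exists_ne_zero_of_sum_ne_zero (h2.trans_ne one_ne_zero)
    obtain ⟨n, w, hn, hw0, hw, hwv, hl, hl'⟩ := hF v ⟨t, ht, h3 v hv⟩
    obtain ⟨φ, hφ⟩ := exists_openStar_chart F v hn w hw0 hw hwv hl hl'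
    let θ : ℝ × ℝ ≃ₜ EuclideanSpace ℝ (Fin 2) :=
      Homeomorph.finTwoArrow.symm.trans (EuclideanSpace.equiv (Fin 2) ℝ).symm.toHomeomorph
    refine ⟨φ.trans θ.toOpenPartialHomeomorph, ?_⟩
    simp [hφ, hv]
  choose φ hφ using key
  exact ⟨{ atlas := Set.range φ
           chartAt := φ
           mem_chart_source := hφ
           chart_mem_atlas := fun x => ⟨x, rfl⟩ }⟩

/-- In a mod `2` two-cycle, every edge lies in an even number of triangles. -/
theorem even_card_support_filter_of_chainBoundary_eq_zero {E : Type*} {c : SimplicialChain E}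
    (hcard : ∀ s ∈ c.support, s.card = 3) (hc : chainBoundary c = 0) {a b : E} (hab : a ≠ b) :
    Even (c.support.filter fun t => a ∈ t ∧ b ∈ t).card := by
  have h := DFunLike.congr_fun hc ({a, b} : Finset E)
  rw [← ZMod.natCast_eq_zero_iff_even, Finset.card_filter]
  rw [chainBoundary, Finsupp.sum, Finsupp.finsetSum_apply] at h
  rw [Finsupp.zero_apply] at h
  rw [← h]
  push_cast
  refine Finset.sum_congr rfl fun t ht => ?_
  have h1 : c t = 1 := by
    have := Finsupp.mem_support_iff.1 ht
    generalize c t = x at this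
    revert x
    decide
  rw [h1, one_smul, Finset.sum_apply]
  simp only [Finsupp.single_apply]
  split_ifs with h
  · obtain ⟨x, hx⟩ : ∃ x, (t.erase a).erase b = {x} := by
      rw [← Finset.card_eq_one, Finset.card_erase_of_mem (Finset.mem_erase.2 ⟨hab.symm, h.2⟩),
        Finset.card_erase_of_mem h.1, hcard t ht]
    have hx' : x ∈ (t.erase a).erase b := by simp [hx]
    simp only [Finset.mem_erase] at hx'
    have ht' : t = {a, b, x} := by
      rw [← Finset.insert_erase h.1, ← Finset.insert_erase (Finset.mem_erase.2 ⟨hab.symm, h.2⟩), hx]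
    rw [Finset.sum_eq_single x]
    · rw [if_pos]
      rw [ht']
      ext z
      simp only [Finset.mem_erase, Finset.mem_insert, Finset.mem_singleton]
      grind
    · intro z hz hzx
      rw [if_neg]
      intro hzab
      have : x ∈ t.erase z := Finset.mem_erase.2 ⟨hzx.symm, hx'.2.2⟩
      rw [hzab] at this
      simp only [Finset.mem_insert, Finset.mem_singleton] at this
      rcases this with h' | h'
      · exact hx'.2.1 h'
      · exact hx'.1 h'
    · exact fun h' => (h' hx'.2.2).elim
  · refine (Finset.sum_eq_zero fun x _ => if_neg fun hx => h ?_).symm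
    have ha : a ∈ t.erase x := by simp [hx]
    have hb : b ∈ t.erase x := by simp [hx]
    exact ⟨Finset.mem_of_mem_erase ha, Finset.mem_of_mem_erase hb⟩

theorem chainMap_sum_single {E' E : Type*} [DecidableEq E] (φ : E' → E)
    (S : Finset (Finset E')) :
    chainMap φ (∑ s ∈ S, Finsupp.single s 1) = ∑ s ∈ S, Finsupp.single (s.image φ) 1 := by
  obtain rfl : ‹DecidableEq E› = fun _ _ => Classical.propDecidable _ := Subsingleton.elim _ _
  rw [chainMap, ← Finsupp.sum_finsetSum_index (by simp) (by simp)]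
  simp

theorem sum_single_support_eq {E : Type*} (c : SimplicialChain E) :
    ∑ s ∈ c.support, Finsupp.single s 1 = c := by
  conv_rhs => rw [← c.sum_single]
  refine Finset.sum_congr rfl fun s hs => ?_
  have := Finsupp.mem_support_iff.1 hs
  generalize c s = x at *
  congr 1
  revert x
  decide

/-- **Lemma (realization of 2-dimensional `ℤ/2`-homology classes by surfaces).**
Let `X` be a finite simplicial complex and let `[C] ∈ H₂(X; ℤ/2)` be a nontrivial
homology class, represented by a `2`-cycle `c` which is not the boundary of a
`3`-chain.  Then there exist a triangulated closed surface `S` (possibly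
non-orientable and possibly disconnected) — a finite simplicial complex `L` whose
underlying space is a compact topological `2`-manifold — together with a
non-degenerate simplicial map `h : S → X` (given by the vertex map `φ`) such that
`h₂[S] = [C]` where `[S]` is the `ℤ/2` fundamental class, i.e. `h` applied to the sum
of all `2`-simplices of `S` differs from `c` by a boundary.  Moreover `h` does not
identify `2`-simplices: distinct `2`-simplices of `S` have distinct images. -/
theorem exists_surface_representing_homology_class {m : ℕ}
    (K : Geometry.SimplicialComplex ℝ (EuclideanSpace ℝ (Fin m)))
    (hKfin : K.faces.Finite)
    (c : SimplicialChain (EuclideanSpace ℝ (Fin m)))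
    (hc : IsChainOf K 2 c) (hcycle : chainBoundary c = 0)
    (hnontrivial : ¬ ∃ b, IsChainOf K 3 b ∧ chainBoundary b = c) :
    ∃ (m' : ℕ) (L : Geometry.SimplicialComplex ℝ (EuclideanSpace ℝ (Fin m')))
      (hLfin : L.faces.Finite) (φ : EuclideanSpace ℝ (Fin m') → EuclideanSpace ℝ (Fin m)),
      -- `S = |L|` is a triangulated closed surface (compact `2`-manifold)
      Nonempty (ChartedSpace (EuclideanSpace ℝ (Fin 2)) ↥L.space) ∧
      CompactSpace ↥L.space ∧
      (∀ s ∈ L.faces, s.card ≤ 3) ∧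
      -- `φ` is the vertex map of a simplicial map `h : L → K`
      (∀ s ∈ L.faces, s.image φ ∈ K.faces) ∧
      -- which is non-degenerate
      (∀ s ∈ L.faces, (s.image φ).card = s.card) ∧
      -- and does not identify `2`-simplices
      (∀ s ∈ L.faces, ∀ t ∈ L.faces, s.card = 3 → t.card = 3 →
        s.image φ = t.image φ → s = t) ∧
      -- and `h₂[S] = [C]` in `H₂(X; ℤ/2)`
      ∃ b, IsChainOf K 3 b ∧
        chainMap φ (fundamentalChain2 L hLfin) = c + chainBoundary b := by
  set T := c.support with hT
  have hcard : ∀ t ∈ T, t.card = 3 := fun t ht => (hc t ht).2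
  obtain ⟨N, f, τ, hinj, himg, heven, hmin⟩ := exists_minimal_unfolding T fun a b hab =>
    even_card_support_filter_of_chainBoundary_eq_zero hcard hcycle hab
  replace himg : ∀ t ∈ T, (τ t).image f = t := fun t ht => by convert himg t ht
  have hτ : Set.InjOn τ T := fun s hs t ht h => by rw [← himg s hs, ← himg t ht, h]
  have hτcard : ∀ t ∈ T, (τ t).card = 3 := fun t ht => by
    rw [← Finset.card_image_of_injOn (hinj t), himg t ht, hcard t ht]
  let e : Fin N → EuclideanSpace ℝ (Fin N) := fun i => EuclideanSpace.single i 1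
  have he : Function.Injective e := by
    intro i j hij
    by_contra h
    simpa [e, h] using congrArg (fun x => x i) hij
  let φ : EuclideanSpace ℝ (Fin N) → EuclideanSpace ℝ (Fin m) := Function.extend e f 0
  have hφ : ∀ r : Finset (Fin N), (r.image e).image φ = r.image f := by
    intro r
    rw [Finset.image_image]
    exact Finset.image_congr fun i _ => he.extend_apply f 0 i
  have hfaces : ∀ s ∈ (standardRealization (T.image τ)).faces, ∃ r : Finset (Fin N), r.Nonempty ∧
      s = r.image e ∧ ∃ t ∈ T, r ⊆ τ t := by
    intro s hs
    obtain ⟨r, ⟨hr, t', ht', hrt⟩, rfl⟩ := mem_standardRealization_faces.1 hs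
    obtain ⟨t, ht, rfl⟩ := Finset.mem_image.1 ht'
    exact ⟨r, hr, rfl, t, ht, hrt⟩
  have htri : ∀ s ∈ (standardRealization (T.image τ)).faces, s.card = 3 →
      ∃ t ∈ T, s = (τ t).image e := by
    intro s hs hs3
    obtain ⟨r, -, rfl, t, ht, hrt⟩ := hfaces s hs
    rw [Finset.card_image_of_injective _ he] at hs3
    exact ⟨t, ht, by rw [Finset.eq_of_subset_of_card_le hrt (by rw [hs3, hτcard t ht])]⟩
  refine ⟨N, standardRealization (T.image τ), standardRealization_faces_finite _, φ,
    nonempty_chartedSpace_standardRealization _ ?_, compactSpace_standardRealization _,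
    ?_, ?_, ?_, ?_, 0, ?_, ?_⟩
  · rintro v ⟨t', ht', hvt⟩
    obtain ⟨t, ht, rfl⟩ := Finset.mem_image.1 ht'
    obtain ⟨n, w, h1, h2, h3, h4, h5, h6⟩ :=
      exists_cyclic_link T τ hτ hτcard heven v ⟨t, ht, hvt⟩ (hmin v)
    refine ⟨n, w, h1, h2, h3, h4, ?_, fun i hi => ?_⟩
    · intro s' hs' hvs
      obtain ⟨s, hs, rfl⟩ := Finset.mem_image.1 hs'
      exact h5 s hs hvs
    · obtain ⟨s, hs, h⟩ := h6 i hi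
      exact h ▸ Finset.mem_image_of_mem τ hs
  · intro s hs
    obtain ⟨r, -, rfl, t, ht, hrt⟩ := hfaces s hs
    rw [Finset.card_image_of_injective _ he, ← hτcard t ht]
    exact Finset.card_le_card hrt
  · intro s hs
    obtain ⟨r, hr, rfl, t, ht, hrt⟩ := hfaces s hs
    rw [hφ]
    refine K.down_closed (hc t ht).1 ?_ (hr.image f)
    conv_rhs => rw [← himg t ht]
    exact Finset.image_subset_image hrt
  · intro s hs
    obtain ⟨r, -, rfl, t, ht, hrt⟩ := hfaces s hs
    rw [hφ, Finset.card_image_of_injective _ he]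
    exact Finset.card_image_of_injOn ((hinj t).mono (Finset.coe_subset.2 hrt))
  · intro s hs s' hs' h3 h3' h
    obtain ⟨t, ht, rfl⟩ := htri s hs h3
    obtain ⟨t', ht', rfl⟩ := htri s' hs' h3'
    rw [hφ, hφ, himg t ht, himg t' ht'] at h
    rw [h]
  · intro s hs
    simp at hs
  · have h0 : chainBoundary (0 : SimplicialChain (EuclideanSpace ℝ (Fin m))) = 0 :=
      Finsupp.sum_zero_index
    rw [h0, add_zero, fundamentalChain2, chainMap_sum_single]
    conv_rhs => rw [← sum_single_support_eq c]
    symm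
    refine Finset.sum_bij (fun t _ => (τ t).image e) ?_ ?_ ?_ ?_
    · intro t ht
      rw [Finset.mem_filter, Set.Finite.mem_toFinset, Finset.card_image_of_injective _ he]
      exact ⟨mem_standardRealization_faces.2 ⟨τ t, ⟨Finset.card_pos.1 (by rw [hτcard t ht]; omega),
        τ t, Finset.mem_image_of_mem τ ht, subset_rfl⟩, rfl⟩, hτcard t ht⟩
    · intro t ht t' ht' h
      exact hτ ht ht' (Finset.image_injective he h)
    · intro s hs
      rw [Finset.mem_filter, Set.Finite.mem_toFinset] at hs
      obtain ⟨t, ht, rfl⟩ := htri s hs.1 hs.2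
      exact ⟨t, ht, rfl⟩
    · intro t ht
      rw [hφ, himg t ht]

end
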